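/- Let n be odd, i an integer with 1 ≤ i < n and gcd(i,n) = 1, and F : F_{2^n} → F_{2^n} the Gold function F(x) = x^{2^i+1}. Then the set S_F = {(x, F(x)) : x ∈ F_{2^n}} is formally self dual under the trace pairing ⟨(x,y),(a,b)⟩ = (−1)^{Tr(ax+by)} if and only if n = 3. Moreover, for n = 3 both i = 1 and i = 2 yield formally self dual sets. -/

import Mathlib

open scoped Classical

/-- The sign `(−1)^{Tr(t)} ∈ ℤ`, with `Tr` the absolute trace of `F_{2^n}`. -/
noncomputable def sgn {n : ℕ} (t : GaloisField 2 n) : ℤ :=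
  (-1) ^ (Algebra.trace (ZMod 2) (GaloisField 2 n) t).val

/-- The weight enumerator `ν_S(a,b) = #{(u,v) ∈ S×S : u − v = (a,b)}`. -/
noncomputable def nu2 {n : ℕ} (S : Set (GaloisField 2 n × GaloisField 2 n))
    (g : GaloisField 2 n × GaloisField 2 n) : ℕ :=
  Nat.card {q : (GaloisField 2 n × GaloisField 2 n) × (GaloisField 2 n × GaloisField 2 n) //
    q.1 ∈ S ∧ q.2 ∈ S ∧ q.1 - q.2 = g}

/-- `S ⊆ F_{2^n} × F_{2^n}` is formally self dual under the trace pairing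
`⟨(x,y),(a,b)⟩ = (−1)^{Tr(ax+by)}`. -/
noncomputable def FSDTrace {n : ℕ} (S : Set (GaloisField 2 n × GaloisField 2 n)) : Prop :=
  ∀ a b : GaloisField 2 n,
    (∑ᶠ s ∈ S, sgn (a * s.1 + b * s.2)) ^ 2 = (Nat.card S : ℤ) * nu2 S (a, b)

/-- The graph `S_F = {(x, F(x)) : x ∈ F_{2^n}}`. -/
def graphSet {n : ℕ} (F : GaloisField 2 n → GaloisField 2 n) :
    Set (GaloisField 2 n × GaloisField 2 n) :=
  {q | ∃ x : GaloisField 2 n, q = (x, F x)}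

/-- `δ_F(a,b) = #{x : F(x+a) + F(x) = b}`. -/
noncomputable def deltaF {n : ℕ} (F : GaloisField 2 n → GaloisField 2 n)
    (a b : GaloisField 2 n) : ℕ :=
  Nat.card {x : GaloisField 2 n // F (x + a) + F x = b}

/-- The Walsh transform `W_F(a,b) = ∑_x (−1)^{Tr(bF(x)+ax)}`. -/
noncomputable def walsh {n : ℕ} (F : GaloisField 2 n → GaloisField 2 n)
    (a b : GaloisField 2 n) : ℤ :=
  ∑ᶠ x : GaloisField 2 n, sgn (b * F x + a * x)

lemma sum_mul_ite_zero_or_one {K R : Type*} [Field K] [Fintype K] [NonAssocSemiring R]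
    (f : K → R) (r : R) :
    ∑ x, f x * (if x = 0 ∨ x = 1 then r else 0) = f 0 * r + f 1 * r := by
  have h (x : K) : f x * (if x = 0 ∨ x = 1 then r else 0) =
      (if x = 0 then f 0 * r else 0) + if x = 1 then f 1 * r else 0 := by
    by_cases h0 : x = 0 <;> by_cases h1 : x = 1 <;> simp_all
  rw [Finset.sum_congr rfl fun x _ => h x, Finset.sum_add_distrib]
  simp

section Sign

variable {n : ℕ}

lemma sgn_zero : sgn (0 : GaloisField 2 n) = 1 := by
  simp [sgn]

lemma sgn_add (s t : GaloisField 2 n) : sgn (s + t) = sgn s * sgn t := by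
  have key : ∀ u v : ZMod 2, (-1 : ℤ) ^ (u + v).val = (-1) ^ u.val * (-1) ^ v.val := by decide
  rw [sgn, map_add, key, sgn, sgn]

lemma trace_eq_of_sgn_eq {s t : GaloisField 2 n} (h : sgn s = sgn t) :
    Algebra.trace (ZMod 2) (GaloisField 2 n) s = Algebra.trace (ZMod 2) (GaloisField 2 n) t := by
  have key : ∀ u v : ZMod 2, (-1 : ℤ) ^ u.val = (-1) ^ v.val → u = v := by decide
  exact key _ _ h

lemma sgn_one (hn : Odd n) : sgn (1 : GaloisField 2 n) = -1 := by
  have hn0 : n ≠ 0 := hn.pos.ne'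
  have h : Algebra.trace (ZMod 2) (GaloisField 2 n) 1 = 1 := by
    rw [← map_one (algebraMap (ZMod 2) (GaloisField 2 n)), Algebra.trace_algebraMap,
      GaloisField.finrank 2 hn0, nsmul_one]
    exact ZMod.natCast_eq_one_iff_odd.2 hn
  rw [sgn, h]
  rfl

lemma sgn_pow_two_pow (i : ℕ) (t : GaloisField 2 n) : sgn (t ^ 2 ^ i) = sgn t := by
  induction i with
  | zero => simp
  | succ k ih =>
    have h := Algebra.trace_eq_of_algEquiv
      (FiniteField.frobeniusAlgEquivOfAlgebraic (ZMod 2) (GaloisField 2 n)) (t ^ 2 ^ k)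
    simp only [FiniteField.coe_frobeniusAlgEquivOfAlgebraic, ZMod.card] at h
    rw [← ih, pow_succ, pow_mul, sgn, h, sgn]

lemma card_galoisField [Fintype (GaloisField 2 n)] (hn : n ≠ 0) :
    Fintype.card (GaloisField 2 n) = 2 ^ n := by
  rw [← Nat.card_eq_fintype_card, GaloisField.card 2 n hn]

lemma sum_sgn_mul [Fintype (GaloisField 2 n)] (hn : n ≠ 0) (c : GaloisField 2 n) :
    ∑ x, sgn (c * x) = if c = 0 then (2 : ℤ) ^ n else 0 := by
  split_ifs with hc
  · simp [hc, sgn_zero, card_galoisField hn]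
  · obtain ⟨b, hb⟩ : ∃ b, sgn (c * b) ≠ 1 := by
      by_contra! h
      obtain ⟨t, ht⟩ := Algebra.trace_surjective (ZMod 2) (GaloisField 2 n) 1
      have := trace_eq_of_sgn_eq ((h (c⁻¹ * t)).trans sgn_zero.symm)
      rw [mul_inv_cancel_left₀ hc, ht, map_zero] at this
      exact one_ne_zero this
    refine eq_zero_of_mul_eq_self_left hb ?_
    rw [Finset.mul_sum]
    simp only [← sgn_add, ← mul_add]
    exact Fintype.sum_equiv (Equiv.addLeft b) _ _ fun x => rfl

lemma sum_sgn_mul_pow [Fintype (GaloisField 2 n)] (hn : n ≠ 0) (i : ℕ) (c : GaloisField 2 n) :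
    ∑ x, sgn (c * x ^ 2 ^ i) = if c = 0 then (2 : ℤ) ^ n else 0 := by
  rw [← sum_sgn_mul hn]
  refine Fintype.sum_bijective (fun x : GaloisField 2 n => x ^ 2 ^ i)
    (Finite.injective_iff_bijective.1 ?_) _ _ fun x => rfl
  exact iterateFrobenius_inj (GaloisField 2 n) 2 i

end Sign

section Gold

variable {n i : ℕ}

lemma coprime_two_pow_two_mul_sub_one (hn : Odd n) (hi : Nat.gcd i n = 1) :
    Nat.Coprime (2 ^ (2 * i) - 1) (2 ^ n - 1) := by
  have h : Nat.gcd (2 * i) n = 1 :=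
    Nat.Coprime.mul_left (Nat.coprime_two_left.2 hn) hi
  rw [Nat.Coprime, Nat.pow_sub_one_gcd_pow_sub_one, h, pow_one]

lemma coprime_two_pow_add_one (hn : Odd n) (hi : Nat.gcd i n = 1) :
    Nat.Coprime (2 ^ i + 1) (2 ^ n - 1) := by
  refine (coprime_two_pow_two_mul_sub_one hn hi).coprime_dvd_left ⟨2 ^ i - 1, ?_⟩
  rw [mul_comm 2, pow_mul, ← Nat.sq_sub_sq, one_pow]

lemma pow_card_sub_one_eq_one (hn : n ≠ 0) {c : GaloisField 2 n} (hc : c ≠ 0) :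
    c ^ (2 ^ n - 1) = 1 := by
  have := Fintype.ofFinite (GaloisField 2 n)
  rw [← card_galoisField hn]
  exact FiniteField.pow_card_sub_one_eq_one c hc

lemma add_pow_pow_eq_zero_iff (hn : Odd n) (hi : Nat.gcd i n = 1) (c : GaloisField 2 n) :
    c + (c ^ 2 ^ i) ^ 2 ^ i = 0 ↔ c = 0 ∨ c = 1 := by
  constructor
  · intro h
    by_cases hc : c = 0
    · exact Or.inl hc
    right
    have h2 : c ^ (2 ^ (2 * i) - 1) = 1 := by
      rw [CharTwo.add_eq_zero, ← pow_mul, ← pow_add, ← two_mul] at h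
      apply mul_right_cancel₀ hc
      rw [← pow_succ, Nat.sub_add_cancel Nat.one_le_two_pow, ← h, one_mul]
    rw [← orderOf_eq_one_iff, ← Nat.dvd_one, ← coprime_two_pow_two_mul_sub_one hn hi]
    exact Nat.dvd_gcd (orderOf_dvd_of_pow_eq_one h2)
      (orderOf_dvd_of_pow_eq_one (pow_card_sub_one_eq_one hn.pos.ne' hc))
  · rintro (rfl | rfl) <;> simp [CharTwo.add_self_eq_zero]

lemma add_pow_eq_zero_iff (hn : Odd n) (hi : Nat.gcd i n = 1) (c : GaloisField 2 n) :
    c + c ^ 2 ^ i = 0 ↔ c = 0 ∨ c = 1 := by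
  constructor
  · intro h
    rw [← add_pow_pow_eq_zero_iff hn hi]
    rw [CharTwo.add_eq_zero] at h ⊢
    rw [← h, ← h]
  · rintro (rfl | rfl) <;> simp [CharTwo.add_self_eq_zero]

lemma sum_sgn_gold_sq [Fintype (GaloisField 2 n)] (hn : Odd n) (hi : Nat.gcd i n = 1)
    (t : GaloisField 2 n) :
    (∑ x, sgn (t * x + x ^ (2 ^ i + 1))) ^ 2 = 2 ^ n * (1 - sgn t) := by
  have expand (x h : GaloisField 2 n) :
      sgn (t * x + x ^ (2 ^ i + 1)) * sgn (t * (h + x) + (h + x) ^ (2 ^ i + 1)) =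
        sgn (t * h + h ^ (2 ^ i + 1)) * sgn ((h + (h ^ 2 ^ i) ^ 2 ^ i) * x ^ 2 ^ i) := by
    have h1 : sgn ((h + (h ^ 2 ^ i) ^ 2 ^ i) * x ^ 2 ^ i)
        = sgn (h * x ^ 2 ^ i + h ^ 2 ^ i * x) := by
      rw [add_mul, ← mul_pow, sgn_add, sgn_pow_two_pow, ← sgn_add]
    rw [h1, ← sgn_add, ← sgn_add]
    congr 1
    have h2 : (h + x) ^ 2 ^ i = h ^ 2 ^ i + x ^ 2 ^ i := add_pow_char_pow h x 2 i
    rw [pow_succ, pow_succ, pow_succ, h2]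
    linear_combination (t * x + x ^ 2 ^ i * x) * CharTwo.two_eq_zero (R := GaloisField 2 n)
  have h0 : ∀ x, ∑ y, sgn (t * x + x ^ (2 ^ i + 1)) * sgn (t * y + y ^ (2 ^ i + 1)) =
      ∑ h, sgn (t * x + x ^ (2 ^ i + 1)) * sgn (t * (h + x) + (h + x) ^ (2 ^ i + 1)) := fun x =>
    (Fintype.sum_equiv (Equiv.addRight x) _ _ fun h => rfl).symm
  rw [sq, Finset.sum_mul_sum, Finset.sum_congr rfl fun x _ => h0 x, Finset.sum_comm]
  simp only [expand, ← Finset.mul_sum, sum_sgn_mul_pow hn.pos.ne', add_pow_pow_eq_zero_iff hn hi]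
  rw [sum_mul_ite_zero_or_one (fun h => sgn (t * h + h ^ (2 ^ i + 1)))]
  simp [sgn_add, sgn_zero, sgn_one hn]
  ring

lemma card_pow_add_self_eq (hn : Odd n) (hi : Nat.gcd i n = 1) (w : GaloisField 2 n) :
    (Nat.card {z : GaloisField 2 n // z ^ 2 ^ i + z = w} : ℤ) = 1 + sgn w := by
  have := Fintype.ofFinite (GaloisField 2 n)
  have hn0 := hn.pos.ne'
  have h1 : (2 : ℤ) ^ n * Nat.card {z : GaloisField 2 n // z ^ 2 ^ i + z = w} =
      ∑ z, ∑ c, sgn ((z ^ 2 ^ i + z + w) * c) := by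
    simp only [sum_sgn_mul hn0, CharTwo.add_eq_zero]
    rw [Nat.card_eq_fintype_card, Fintype.card_subtype, Finset.card_filter, Nat.cast_sum,
      Finset.mul_sum]
    simp
  have expand (z c : GaloisField 2 n) : sgn ((z ^ 2 ^ i + z + w) * c) =
      sgn (w * c) * sgn ((c + c ^ 2 ^ i) * z ^ 2 ^ i) := by
    rw [add_mul c, ← mul_pow, sgn_add, sgn_pow_two_pow, ← sgn_add, ← sgn_add]
    congr 1
    ring
  apply mul_left_cancel₀ (pow_ne_zero n (two_ne_zero (α := ℤ)))
  rw [h1, Finset.sum_comm]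
  simp only [expand, ← Finset.mul_sum, sum_sgn_mul_pow hn0, add_pow_eq_zero_iff hn hi]
  rw [sum_mul_ite_zero_or_one (fun h => sgn (w * h))]
  simp [sgn_zero]
  ring

lemma finsum_mem_graphSet [Fintype (GaloisField 2 n)] (F : GaloisField 2 n → GaloisField 2 n)
    (a b : GaloisField 2 n) :
    ∑ᶠ s ∈ graphSet F, sgn (a * s.1 + b * s.2) = ∑ x, sgn (a * x + b * F x) := by
  have h : graphSet F = Set.range fun x => (x, F x) := by
    ext q
    simp [graphSet, eq_comm]
  rw [h, finsum_mem_range fun x y hxy => (Prod.mk.inj hxy).1, finsum_eq_sum_of_fintype]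

lemma card_graphSet (hn : n ≠ 0) (F : GaloisField 2 n → GaloisField 2 n) :
    Nat.card (graphSet F) = 2 ^ n := by
  rw [← GaloisField.card 2 n hn]
  refine (Nat.card_eq_of_bijective (fun x => (⟨(x, F x), x, rfl⟩ : graphSet F))
    ⟨?_, ?_⟩).symm
  · exact fun x y hxy => (Prod.mk.inj (Subtype.ext_iff.1 hxy)).1
  · rintro ⟨_, x, rfl⟩
    exact ⟨x, rfl⟩

lemma nu2_graphSet (F : GaloisField 2 n → GaloisField 2 n) (a b : GaloisField 2 n) :
    nu2 (graphSet F) (a, b) = deltaF F a b := by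
  have hsub (x : {x // F (x + a) + F x = b}) :
      ((x.1 + a, F (x.1 + a)) - (x.1, F x.1) : GaloisField 2 n × GaloisField 2 n) = (a, b) := by
    rw [Prod.mk_sub_mk, add_sub_cancel_left, CharTwo.sub_eq_add, x.2]
  refine (Nat.card_eq_of_bijective
    (fun x => ⟨((x.1 + a, F (x.1 + a)), (x.1, F x.1)), ⟨_, rfl⟩, ⟨_, rfl⟩, hsub x⟩)
    ⟨fun x y hxy => ?_, ?_⟩).symm
  · exact Subtype.ext (Prod.mk.inj (Prod.mk.inj (Subtype.ext_iff.1 hxy)).2).1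
  · rintro ⟨⟨u, v⟩, hu, hv, h⟩
    obtain ⟨x, rfl : u = _⟩ := id hu
    obtain ⟨y, rfl : v = _⟩ := id hv
    obtain ⟨h1, h2⟩ := Prod.mk.inj h
    obtain rfl : x = y + a := by rw [← h1, add_sub_cancel]
    exact ⟨⟨y, by rw [← h2, CharTwo.sub_eq_add]⟩, rfl⟩

lemma deltaF_gold (hn : Odd n) (hi : Nat.gcd i n = 1) {a : GaloisField 2 n} (ha : a ≠ 0)
    (b : GaloisField 2 n) :
    (deltaF (fun x => x ^ (2 ^ i + 1)) a b : ℤ) = 1 - sgn (b * (a ^ (2 ^ i + 1))⁻¹) := by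
  have h := card_pow_add_self_eq hn hi (b * (a ^ (2 ^ i + 1))⁻¹ + 1)
  rw [sgn_add, sgn_one hn, mul_neg_one, ← sub_eq_add_neg] at h
  rw [← h, Nat.cast_inj]
  refine Nat.card_congr ((Equiv.mulLeft₀ a ha).subtypeEquiv fun z => ?_).symm
  have h1 : (a * z + a) ^ 2 ^ i = (a * z) ^ 2 ^ i + a ^ 2 ^ i := add_pow_char_pow (a * z) a 2 i
  have h2 : (a * z + a) ^ (2 ^ i + 1) + (a * z) ^ (2 ^ i + 1) =
      (z ^ 2 ^ i + z + 1) * a ^ (2 ^ i + 1) := by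
    rw [pow_succ, pow_succ, pow_succ, h1, mul_pow]
    linear_combination (a ^ 2 ^ i * z ^ 2 ^ i * (a * z)) *
      CharTwo.two_eq_zero (R := GaloisField 2 n)
  rw [Equiv.mulLeft₀_apply, h2, ← eq_mul_inv_iff_mul_eq₀ (pow_ne_zero _ ha),
    ← CharTwo.sub_eq_add (b * _), eq_sub_iff_add_eq]

lemma exists_pow_inv_eq (hn : Odd n) (hi : Nat.gcd i n = 1) {b : GaloisField 2 n} (hb : b ≠ 0) :
    ∃ c : GaloisField 2 n, c ≠ 0 ∧ (c ^ (2 ^ i + 1))⁻¹ = b := by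
  have hcard : (Nat.card (GaloisField 2 n)ˣ).Coprime (2 ^ i + 1) := by
    rw [Nat.card_units, GaloisField.card 2 n hn.pos.ne']
    exact (coprime_two_pow_add_one hn hi).symm
  obtain ⟨c, hc⟩ := (powCoprime hcard).surjective (Units.mk0 b hb)⁻¹
  refine ⟨c, c.ne_zero, ?_⟩
  rw [powCoprime_apply] at hc
  rw [← Units.val_pow_eq_pow_val, ← Units.val_inv_eq_inv_val, hc, inv_inv, Units.val_mk0]

lemma sum_sgn_gold_inv_sq [Fintype (GaloisField 2 n)] (hn : Odd n) (hi : Nat.gcd i n = 1)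
    (a : GaloisField 2 n) {c : GaloisField 2 n} (hc : c ≠ 0) :
    (∑ x, sgn (a * x + (c ^ (2 ^ i + 1))⁻¹ * x ^ (2 ^ i + 1))) ^ 2 =
      2 ^ n * (1 - sgn (a * c)) := by
  rw [← sum_sgn_gold_sq hn hi]
  congr 1
  refine (Fintype.sum_equiv (Equiv.mulLeft₀ c hc) _ _ fun x => ?_).symm
  rw [Equiv.mulLeft₀_apply, mul_pow, inv_mul_cancel_left₀ (pow_ne_zero _ hc), mul_assoc]

lemma fsdTrace_gold_iff (hn : Odd n) (hi : Nat.gcd i n = 1) :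
    FSDTrace (graphSet fun x : GaloisField 2 n => x ^ (2 ^ i + 1)) ↔
      ∀ t : GaloisField 2 n, t ≠ 0 → sgn t = sgn (t ^ (2 ^ i + 1))⁻¹ := by
  have := Fintype.ofFinite (GaloisField 2 n)
  have hn0 := hn.pos.ne'
  have h2 : (2 : ℤ) ^ n ≠ 0 := by positivity
  simp only [FSDTrace, finsum_mem_graphSet, card_graphSet hn0, nu2_graphSet, Nat.cast_pow,
    Nat.cast_ofNat]
  constructor
  · intro h t ht
    have h1 := h t 1
    simp only [one_mul] at h1
    rw [sum_sgn_gold_sq hn hi, deltaF_gold hn hi ht, one_mul] at h1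
    linarith [mul_left_cancel₀ h2 h1]
  · intro h a b
    by_cases ha : a = 0
    · subst ha
      by_cases hb : b = 0
      · subst hb
        simp [sgn_zero, deltaF, CharTwo.add_self_eq_zero, card_galoisField hn0, sq]
      · obtain ⟨c, hc, rfl⟩ := exists_pow_inv_eq hn hi hb
        rw [sum_sgn_gold_inv_sq hn hi 0 hc]
        simp [sgn_zero, deltaF, CharTwo.add_self_eq_zero, hc, eq_comm]
    · rw [deltaF_gold hn hi ha]
      by_cases hb : b = 0
      · subst hb
        simp [sgn_zero, sum_sgn_mul hn0, ha]
      · obtain ⟨c, hc, rfl⟩ := exists_pow_inv_eq hn hi hb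
        rw [sum_sgn_gold_inv_sq hn hi a hc, h _ (mul_ne_zero ha hc), mul_pow, mul_inv,
          mul_comm (a ^ _)⁻¹]

lemma not_dvd_one_add_two_pow_add_two_pow {j k : ℕ} (hn : 3 < n) (hj : j < n) (hk : k < n)
    (hjk : j ≠ k) : ¬ 2 ^ n - 1 ∣ 1 + 2 ^ j + 2 ^ k := by
  wlog hlt : j < k generalizing j k
  · rw [add_right_comm]
    exact this hk hj hjk.symm (by lia)
  have h1 : 2 ^ j ≤ 2 ^ (n - 2) := Nat.pow_le_pow_right two_pos (by lia)
  have h2 : 2 ^ k ≤ 2 ^ (n - 1) := Nat.pow_le_pow_right two_pos (by lia)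
  have h3 : 2 ^ n = 2 ^ 2 * 2 ^ (n - 2) := by rw [← pow_add]; congr 1; lia
  have h4 : 2 ^ (n - 1) = 2 * 2 ^ (n - 2) := by rw [← pow_succ']; congr 1; lia
  have h5 : 2 ^ 2 ≤ 2 ^ (n - 2) := Nat.pow_le_pow_right two_pos (by lia)
  exact Nat.not_dvd_of_pos_of_lt (by positivity) (by lia)

lemma le_three_of_forall_sgn_eq (hn : n ≠ 0) (hi1 : 1 ≤ i) (hin : i < n)
    (h : ∀ t : GaloisField 2 n, t ≠ 0 → sgn t = sgn (t ^ (2 ^ i + 1))⁻¹) : n ≤ 3 := by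
  by_contra! hn3
  have := Fintype.ofFinite (GaloisField 2 n)
  have hcard := card_galoisField (n := n) hn
  have trace_eq (x : GaloisField 2 n) :
      algebraMap (ZMod 2) (GaloisField 2 n) (Algebra.trace (ZMod 2) (GaloisField 2 n) x) =
        ∑ j ∈ Finset.range n, x ^ 2 ^ j := by
    rw [FiniteField.algebraMap_trace_eq_sum_pow, GaloisField.finrank 2 hn, Nat.card_zmod]
  have key : ∑ x : (GaloisField 2 n)ˣ, (x : GaloisField 2 n) * ∑ j ∈ Finset.range n,
        ((x : GaloisField 2 n)⁻¹) ^ 2 ^ j =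
      ∑ x : (GaloisField 2 n)ˣ, (x : GaloisField 2 n) * ∑ j ∈ Finset.range n,
        ((x : GaloisField 2 n) ^ (2 ^ i + 1)) ^ 2 ^ j := by
    refine Finset.sum_congr rfl fun x _ => ?_
    have hx := trace_eq_of_sgn_eq (h _ (inv_ne_zero x.ne_zero))
    rw [inv_pow, inv_inv] at hx
    rw [← trace_eq, ← trace_eq, hx]
  have lhs : ∑ x : (GaloisField 2 n)ˣ, (x : GaloisField 2 n) * ∑ j ∈ Finset.range n,
      ((x : GaloisField 2 n)⁻¹) ^ 2 ^ j = -1 := by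
    have hterm (x : (GaloisField 2 n)ˣ) (j : ℕ) :
        (x : GaloisField 2 n) * ((x : GaloisField 2 n)⁻¹) ^ 2 ^ j =
          ((x⁻¹ ^ (2 ^ j - 1) : (GaloisField 2 n)ˣ) : GaloisField 2 n) := by
      obtain ⟨m, hm⟩ := Nat.exists_eq_succ_of_ne_zero (pow_ne_zero j (two_ne_zero (α := ℕ)))
      rw [hm, Nat.succ_sub_one, pow_succ', mul_inv_cancel_left₀ x.ne_zero]
      simp
    simp only [Finset.mul_sum, hterm]
    rw [Finset.sum_comm]
    have hsum (j : ℕ) : ∑ x : (GaloisField 2 n)ˣ,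
        ((x⁻¹ ^ (2 ^ j - 1) : (GaloisField 2 n)ˣ) : GaloisField 2 n) =
          if 2 ^ n - 1 ∣ 2 ^ j - 1 then -1 else 0 := by
      rw [← hcard, ← FiniteField.sum_pow_units]
      exact Fintype.sum_equiv (Equiv.inv _) _ _ fun x => by simp
    rw [Finset.sum_congr rfl fun j _ => hsum j, Finset.sum_eq_single 0]
    · simp
    · intro j hj hj0
      have h1 : 2 ^ j < 2 ^ n := Nat.pow_lt_pow_right one_lt_two (Finset.mem_range.1 hj)
      have h2 : 2 ≤ 2 ^ j := Nat.le_self_pow hj0 2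
      exact if_neg (Nat.not_dvd_of_pos_of_lt (by lia) (by lia))
    · simp [hn]
  have rhs : ∑ x : (GaloisField 2 n)ˣ, (x : GaloisField 2 n) * ∑ j ∈ Finset.range n,
      ((x : GaloisField 2 n) ^ (2 ^ i + 1)) ^ 2 ^ j = 0 := by
    have hterm (x : (GaloisField 2 n)ˣ) (j : ℕ) :
        (x : GaloisField 2 n) * ((x : GaloisField 2 n) ^ (2 ^ i + 1)) ^ 2 ^ j =
          (x : GaloisField 2 n) ^ (1 + 2 ^ j + 2 ^ ((i + j) % n)) := by
      have hred : (x : GaloisField 2 n) ^ 2 ^ ((i + j) % n) =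
          (x : GaloisField 2 n) ^ 2 ^ (i + j) := by
        conv_rhs => rw [← Nat.mod_add_div (i + j) n, pow_add, pow_mul 2 n, ← hcard, pow_mul,
          FiniteField.pow_card_pow]
      rw [pow_add _ (1 + 2 ^ j), hred]
      ring
    simp only [Finset.mul_sum, hterm]
    rw [Finset.sum_comm]
    refine Finset.sum_eq_zero fun j hj => ?_
    rw [Finset.mem_range] at hj
    rw [FiniteField.sum_pow_units, hcard]
    refine if_neg (not_dvd_one_add_two_pow_add_two_pow hn3 hj (Nat.mod_lt _ (by lia)) ?_)
    intro hmod
    rcases lt_or_ge (i + j) n with hlt | hge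
    · rw [Nat.mod_eq_of_lt hlt] at hmod
      lia
    · rw [Nat.mod_eq_sub_mod hge, Nat.mod_eq_of_lt (by lia)] at hmod
      lia
  rw [lhs, rhs] at key
  exact neg_ne_zero.2 one_ne_zero key

lemma sgn_eq_sgn_gold_inv {m : ℕ} (hm : m = 1 ∨ m = 2) (t : GaloisField 2 3) (ht : t ≠ 0) :
    sgn t = sgn (t ^ (2 ^ m + 1))⁻¹ := by
  have h7 : t ^ 7 = 1 := pow_card_sub_one_eq_one three_ne_zero ht
  rcases hm with rfl | rfl
  · rw [← sgn_pow_two_pow 2 t]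
    congr 1
    exact eq_inv_of_mul_eq_one_left ((pow_add t _ _).symm.trans h7)
  · rw [← sgn_pow_two_pow 1 t]
    congr 1
    exact eq_inv_of_mul_eq_one_left ((pow_add t _ _).symm.trans h7)

end Gold

theorem stmt14 (n i : ℕ) (hn : Odd n) (hi1 : 1 ≤ i) (hin : i < n) (hi : Nat.gcd i n = 1) :
    (FSDTrace (graphSet (fun x : GaloisField 2 n => x ^ (2 ^ i + 1))) ↔ n = 3) ∧
    (n = 3 →
      FSDTrace (graphSet (fun x : GaloisField 2 n => x ^ (2 ^ 1 + 1))) ∧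
      FSDTrace (graphSet (fun x : GaloisField 2 n => x ^ (2 ^ 2 + 1)))) := by
  refine ⟨⟨fun h => ?_, ?_⟩, ?_⟩
  · have hle := le_three_of_forall_sgn_eq hn.pos.ne' hi1 hin ((fsdTrace_gold_iff hn hi).1 h)
    obtain ⟨k, rfl⟩ := hn
    lia
  · rintro rfl
    exact (fsdTrace_gold_iff hn hi).2 (sgn_eq_sgn_gold_inv (by lia))
  · rintro rfl
    exact ⟨(fsdTrace_gold_iff hn rfl).2 (sgn_eq_sgn_gold_inv (Or.inl rfl)),
      (fsdTrace_gold_iff hn rfl).2 (sgn_eq_sgn_gold_inv (Or.inr rfl))⟩
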